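/- For every n ≥ 4, the rank of the monoid DPS_n is 5; that is, the minimum cardinality of a subset X ⊆ DPS_n such that the submonoid of DPS_n generated by X equals DPS_n is 5. -/

import Mathlib

namespace DPSPaper

instance instMonoidPFun {V : Type*} : Monoid (V →. V) where
  mul f g := g.comp f
  one := PFun.id V
  mul_assoc a b c := (PFun.comp_assoc c b a).symm
  one_mul := PFun.comp_id
  mul_one := PFun.id_comp

/-- The geodesic distance in the star graph `S_n` on vertices `{0,1,...,n-1}`. -/
def starDist (n : ℕ) (x y : Fin n) : ℕ :=
  if x = y then 0 else if (x : ℕ) = 0 ∨ (y : ℕ) = 0 then 1 else 2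

/-- Injectivity of a partial map. -/
def PInj {n : ℕ} (α : Fin n →. Fin n) : Prop :=
  ∀ ⦃x y a : Fin n⦄, a ∈ α x → a ∈ α y → x = y

/-- `α` is a partial isometry of the star graph `S_n`. -/
def IsStarPI {n : ℕ} (α : Fin n →. Fin n) : Prop :=
  PInj α ∧ ∀ ⦃x y u v : Fin n⦄, u ∈ α x → v ∈ α y → starDist n u v = starDist n x y

/-- The set of all partial isometries of `S_n`. -/
def DPSset (n : ℕ) : Set (Fin n →. Fin n) := { α | IsStarPI α }

theorem mem_mul' {V : Type*} (α β : V →. V) (x c : V) :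
    c ∈ (α * β) x ↔ ∃ b ∈ α x, c ∈ β b := by
  change c ∈ (β.comp α) x ↔ _
  rw [PFun.comp_apply]
  exact Part.mem_bind_iff

theorem mem_one' {V : Type*} (x c : V) : c ∈ (1 : V →. V) x ↔ c = x := by
  change c ∈ (PFun.id V) x ↔ _
  simp [PFun.id]

/-- The partial map with domain `P` given there by `f`. -/
def mkP {V : Type*} (P : V → Prop) (f : V → V) : V →. V := fun x => ⟨P x, fun _ => f x⟩

theorem mem_mkP {V : Type*} (P : V → Prop) (f : V → V) (x b : V) :
    b ∈ mkP P f x ↔ P x ∧ f x = b := by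
  change (∃ h : P x, f x = b) ↔ _
  simp

theorem mkP_mul {V : Type*} (P Q : V → Prop) (f g : V → V) :
    mkP P f * mkP Q g = mkP (fun x => P x ∧ Q (f x)) (fun x => g (f x)) := by
  refine PFun.ext fun x b => ?_
  simp only [mem_mul', mem_mkP]
  grind

theorem mkP_congr {V : Type*} {P Q : V → Prop} {f g : V → V} (h : ∀ x, P x ↔ Q x)
    (h2 : ∀ x, P x → f x = g x) : mkP P f = mkP Q g := by
  refine PFun.ext fun x b => ?_
  simp only [mem_mkP]
  grind

theorem one_eq_mkP {V : Type*} : (1 : V →. V) = mkP (fun _ => True) id := by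
  refine PFun.ext fun x b => ?_
  simp only [mem_mkP, mem_one', id]
  grind

theorem exists_mkP {n : ℕ} (α : Fin n →. Fin n) : ∃ P f, α = mkP P f := by
  classical
  refine ⟨fun x => (α x).Dom, fun x => if h : (α x).Dom then (α x).get h else x, ?_⟩
  refine PFun.ext fun x b => ?_
  simp only [mem_mkP]
  constructor
  · rintro ⟨h, rfl⟩
    exact ⟨h, by simp [h]⟩
  · rintro ⟨h, h2⟩
    rw [dif_pos h] at h2
    exact ⟨h, h2⟩

theorem dist_zero {n : ℕ} {x y : Fin n} : starDist n x y = 0 ↔ x = y := by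
  unfold starDist; split_ifs <;> simp_all

theorem isPI_mkP {n : ℕ} (P : Fin n → Prop) (f : Fin n → Fin n) :
    mkP P f ∈ DPSset n ↔ ∀ x y, P x → P y → starDist n (f x) (f y) = starDist n x y := by
  constructor
  · intro h x y hx hy
    exact h.2 ((mem_mkP ..).2 ⟨hx, rfl⟩) ((mem_mkP ..).2 ⟨hy, rfl⟩)
  · intro h
    constructor
    · intro x y a hx hy
      rw [mem_mkP] at hx hy
      rw [← dist_zero, ← h x y hx.1 hy.1, hx.2, hy.2, dist_zero]
    · intro x y u v hx hy
      rw [mem_mkP] at hx hy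
      rw [← h x y hx.1 hy.1, hx.2, hy.2]

/-- The submonoid of partial isometries. -/
def DPSsub (n : ℕ) : Submonoid (Fin n →. Fin n) where
  carrier := DPSset n
  one_mem' := by
    rw [one_eq_mkP, isPI_mkP]; simp
  mul_mem' := by
    intro a b ha hb
    obtain ⟨P, f, rfl⟩ := exists_mkP a
    obtain ⟨Q, g, rfl⟩ := exists_mkP b
    rw [isPI_mkP] at ha hb
    rw [mkP_mul, isPI_mkP]
    intro x y hx hy
    rw [hb _ _ hx.2 hy.2, ha _ _ hx.1 hy.1]

/-- Extension of a permutation of the leaves. -/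
def ext {m : ℕ} (σ : Fin m → Fin m) : Fin (m+1) → Fin (m+1) :=
  Fin.cases 0 (fun i => (σ i).succ)

@[simp] theorem ext_zero {m : ℕ} (σ : Fin m → Fin m) : ext σ 0 = 0 := rfl
@[simp] theorem ext_succ {m : ℕ} (σ : Fin m → Fin m) (i) : ext σ (Fin.succ i) = (σ i).succ := rfl

@[simp] theorem ext_one {k : ℕ} (σ : Fin (k+3) → Fin (k+3)) : ext σ 1 = (σ 0).succ := rfl

/-- The units. -/
def uhom (m : ℕ) : Equiv.Perm (Fin m) →* (Fin (m+1) →. Fin (m+1)) where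
  toFun σ := mkP (fun _ => True) (ext ⇑σ⁻¹)
  map_one' := by
    rw [one_eq_mkP]
    refine mkP_congr (fun _ => Iff.rfl) fun x _ => ?_
    refine Fin.cases ?_ (fun i => ?_) x <;> simp
  map_mul' σ τ := by
    rw [mkP_mul]
    refine mkP_congr (by simp) fun x _ => ?_
    refine Fin.cases ?_ (fun i => ?_) x <;> simp

theorem uhom_apply {m : ℕ} (σ : Equiv.Perm (Fin m)) :
  uhom m σ = mkP (fun _ => True) (ext ⇑σ⁻¹) := rfl

theorem uhom_mem {m : ℕ} (σ : Equiv.Perm (Fin m)) : uhom m σ ∈ DPSset (m+1) := by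
  rw [uhom_apply, isPI_mkP]
  intro x y _ _
  refine Fin.cases ?_ (fun i => ?_) x <;> refine Fin.cases ?_ (fun j => ?_) y <;>
    simp [starDist, Fin.ext_iff]
  simp [← Fin.ext_iff]

/-- restriction idempotent -/
def res {V : Type*} (P : V → Prop) : V →. V := mkP P id

/-- the swap of 0 and 1 -/
def sw (m : ℕ) : Fin (m+2) →. Fin (m+2) := mkP (fun x => x = 0 ∨ x = 1) (Equiv.swap 0 1)

theorem res_mem {n : ℕ} (P : Fin n → Prop) : res P ∈ DPSset n := by
  rw [res, isPI_mkP]; simp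

theorem dist_comm {n : ℕ} (x y : Fin n) : starDist n x y = starDist n y x := by
  unfold starDist; grind

theorem sw_mem (m : ℕ) : sw m ∈ DPSset (m+2) := by
  rw [sw, isPI_mkP]
  rintro x y (rfl | rfl) (rfl | rfl) <;> simp [starDist]

/-- the generators -/
def gens (k : ℕ) : Set (Fin (k+4) →. Fin (k+4)) :=
  {uhom (k+3) (finRotate (k+3)), uhom (k+3) (Equiv.swap 0 1), res (fun x => x ≠ 0),
    res (fun x => x ≠ 1), sw (k+2)}

theorem gens_sub (k : ℕ) : gens k ⊆ DPSset (k+4) := by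
  rintro x (rfl | rfl | rfl | rfl | rfl)
  · exact uhom_mem _
  · exact uhom_mem _
  · exact res_mem _
  · exact res_mem _
  · exact sw_mem _

theorem perm_closure (k : ℕ) :
    Submonoid.closure ({finRotate (k+3), Equiv.swap 0 1} : Set (Equiv.Perm (Fin (k+3)))) = ⊤ := by
  have h := Equiv.Perm.closure_cycle_adjacent_swap (σ := finRotate (k+3)) (isCycle_finRotate)
    (by simpa using support_finRotate (n := k+1)) 0
  have h1 : finRotate (k+3) 0 = 1 := by simp
  rw [h1] at h
  have := Subgroup.closure_toSubmonoid_of_finite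
    (s := ({finRotate (k+3), Equiv.swap 0 1} : Set (Equiv.Perm (Fin (k+3)))))
  rw [← this, h]; rfl

theorem uhom_cl (k : ℕ) (σ) : uhom (k+3) σ ∈ Submonoid.closure (gens k) := by
  have : Submonoid.closure ({finRotate (k+3), Equiv.swap 0 1} : Set (Equiv.Perm (Fin (k+3))))
      ≤ (Submonoid.closure (gens k)).comap (uhom (k+3)) := by
    rw [Submonoid.closure_le]
    rintro x (rfl | rfl) <;> refine Submonoid.subset_closure ?_ <;> simp [gens]
  rw [perm_closure] at this
  exact this (Submonoid.mem_top σ)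

theorem res1_cl (k : ℕ) (j : Fin (k+4)) : res (fun x => x ≠ j) ∈ Submonoid.closure (gens k) := by
  induction j using Fin.cases with
  | zero => exact Submonoid.subset_closure (by simp [gens])
  | succ i =>
    have h1 : res (fun x => x ≠ 1) ∈ Submonoid.closure (gens k) :=
      Submonoid.subset_closure (by simp [gens])
    have := mul_mem (mul_mem (uhom_cl k (Equiv.swap 0 i)) h1) (uhom_cl k (Equiv.swap 0 i))
    convert this using 1
    rw [uhom_apply, res, res, mkP_mul, mkP_mul]
    refine mkP_congr (fun x => ?_) fun x _ => ?_
    · refine Fin.cases ?_ (fun j => ?_) x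
      · have h0 : (0 : Fin (k+4)) ≠ i.succ := (Fin.succ_ne_zero i).symm
        have h2 : (0 : Fin (k+4)) ≠ 1 := Fin.zero_ne_one
        rw [ext_zero]
        exact ⟨fun _ => ⟨⟨trivial, h2⟩, trivial⟩, fun _ => h0⟩
      · have : (1 : Fin (k+4)) = Fin.succ 0 := rfl
        rw [this, ext_succ, Ne, Ne, Fin.succ_inj, Fin.succ_inj, Equiv.swap_inv, true_and, and_true]
        rw [Equiv.swap_apply_eq_iff, Equiv.swap_apply_left]
    · refine Fin.cases ?_ (fun j => ?_) x <;> simp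

theorem res_cl (k : ℕ) (P : Fin (k+4) → Prop) : res P ∈ Submonoid.closure (gens k) := by
  classical
  have key : ∀ S : Finset (Fin (k+4)), res (fun x => x ∉ S) ∈ Submonoid.closure (gens k) := by
    intro S
    induction S using Finset.induction_on with
    | empty => convert one_mem (Submonoid.closure (gens k)); rw [one_eq_mkP, res]; simp
    | insert a s _ ih =>
      convert mul_mem (res1_cl k a) ih using 1
      rw [res, res, res, mkP_mul]
      exact mkP_congr (by simp) (by simp)
  convert key (Finset.univ.filter fun x => ¬ P x) using 2
  simp

theorem restr {k : ℕ} (P Q : Fin (k+4) → Prop) (f g : Fin (k+4) → Fin (k+4))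
    (hg : mkP Q g ∈ Submonoid.closure (gens k)) (h : ∀ x, P x → Q x ∧ f x = g x) :
    mkP P f ∈ Submonoid.closure (gens k) := by
  convert mul_mem (res_cl k P) hg using 1
  rw [res, mkP_mul]
  exact mkP_congr (by grind) (by grind)

theorem swap_case {k : ℕ} (P : Fin (k+4) → Prop) (f : Fin (k+4) → Fin (k+4)) (a b : Fin (k+3))
    (h : ∀ x, P x → (x = 0 ∧ f x = b.succ) ∨ (x = a.succ ∧ f x = 0)) :
    mkP P f ∈ Submonoid.closure (gens k) := by
  have hs : sw (k+2) ∈ Submonoid.closure (gens k) :=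
      Submonoid.subset_closure (by simp [gens])
  have := mul_mem (mul_mem (uhom_cl k (Equiv.swap 0 a)) hs) (uhom_cl k (Equiv.swap 0 b))
  rw [uhom_apply, uhom_apply, sw, mkP_mul, mkP_mul] at this
  refine restr _ _ _ _ this fun x hx => ?_
  obtain ⟨rfl, h2⟩ | ⟨rfl, h2⟩ := h x hx
  · simp [h2]
  · simp [h2]

theorem unit_case {k : ℕ} (P : Fin (k+4) → Prop) (f : Fin (k+4) → Fin (k+4))
    (hinj : ∀ x y, P x → P y → f x = f y → x = y)
    (h : ∀ x, P x → (f x = 0 ↔ x = 0)) :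
    mkP P f ∈ Submonoid.closure (gens k) := by
  classical
  have h1 : ∀ i : Fin (k+3), ∃ j : Fin (k+3), P i.succ → f i.succ = j.succ := by
    intro i
    by_cases hi : P i.succ
    · have : f i.succ ≠ 0 := by rw [Ne, h _ hi]; exact Fin.succ_ne_zero i
      obtain ⟨j, hj⟩ := Fin.exists_succ_eq.2 this
      exact ⟨j, fun _ => hj.symm⟩
    · exact ⟨0, fun h => absurd h hi⟩
  choose g hg using h1
  obtain ⟨e, he⟩ := Finset.exists_equiv_extend_of_card_eq (α := Fin (k+3)) (β := Fin (k+3))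
    (t := Finset.univ) (by simp) (s := Finset.univ.filter fun i => P i.succ) (f := g)
    (by simp) (by
      intro x hx y hy hxy
      simp at hx hy
      have := hinj _ _ hx hy (by rw [hg _ hx, hg _ hy, hxy])
      exact Fin.succ_injective _ this)
  let σ : Equiv.Perm (Fin (k+3)) := e.trans (Equiv.subtypeUnivEquiv (by simp))
  have hσ : ∀ i, P i.succ → σ i = g i := fun i hi => he i (by simpa using hi)
  have := uhom_cl k σ⁻¹
  rw [uhom_apply] at this
  refine restr _ _ _ _ this fun x hx => ⟨trivial, ?_⟩
  revert hx
  refine Fin.cases ?_ (fun j => ?_) x <;> intro hx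
  · simpa using h _ hx
  · simp [hg _ hx, hσ _ hx]

theorem dist0 {n : ℕ} (x : Fin (n+1)) (hx : x ≠ 0) : starDist (n+1) 0 x = 1 := by
  simp [starDist, hx.symm]

theorem dist1 {n : ℕ} (x y : Fin (n+1)) (h : starDist (n+1) x y = 1) : 
    (x = 0 ∧ y ≠ 0) ∨ (x ≠ 0 ∧ y = 0) := by
  unfold starDist at h
  simp only [Fin.val_eq_zero_iff] at h
  grind

theorem dist2 {n : ℕ} (x y : Fin (n+1)) : starDist (n+1) x y = 2 ↔ x ≠ 0 ∧ y ≠ 0 ∧ x ≠ y := by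
  unfold starDist 
  simp only [Fin.val_eq_zero_iff]
  grind

theorem gens_closure (k : ℕ) :
    (↑(Submonoid.closure (gens k)) : Set (Fin (k+4) →. Fin (k+4))) = DPSset (k+4) := by
  apply Set.Subset.antisymm
  · have : Submonoid.closure (gens k) ≤ DPSsub (k+4) := by
      rw [Submonoid.closure_le]; exact gens_sub k
    exact this
  · intro α hα
    obtain ⟨P, f, rfl⟩ := exists_mkP α
    rw [isPI_mkP] at hα
    have hinj : ∀ x y, P x → P y → f x = f y → x = y := by
      intro x y hx hy hxy
      rw [← dist_zero, ← hα x y hx hy, hxy, dist_zero]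
    by_cases h0 : P 0 ∧ f 0 ≠ 0
    · obtain ⟨hP, hf⟩ := h0
      obtain ⟨b, hb⟩ := Fin.exists_succ_eq.2 hf
      have hx0 : ∀ x, P x → x ≠ 0 → f x = 0 := by
        intro x hx hx0
        have := hα 0 x hP hx
        rw [dist0 x hx0] at this
        have := dist1 _ _ this
        tauto
      by_cases h1 : ∃ x, P x ∧ x ≠ 0
      · obtain ⟨x, hx, hx1⟩ := h1
        obtain ⟨a, ha⟩ := Fin.exists_succ_eq.2 hx1
        refine swap_case P f a b fun y hy => ?_
        by_cases hy0 : y = 0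
        · left; rw [hy0]; exact ⟨rfl, hb.symm⟩
        · right
          exact ⟨ha ▸ hinj _ _ hy hx (by rw [hx0 _ hy hy0, hx0 _ hx hx1]), hx0 _ hy hy0⟩
      · push Not at h1
        refine swap_case P f 0 b fun y hy => ?_
        left; rw [h1 y hy]; exact ⟨rfl, hb.symm⟩
    · by_cases h1 : ∃ x, P x ∧ x ≠ 0 ∧ f x = 0
      · obtain ⟨x, hx, hx1, hfx⟩ := h1
        obtain ⟨a, ha⟩ := Fin.exists_succ_eq.2 hx1
        refine swap_case P f a 0 fun y hy => ?_
        right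
        have : y = x := by
          by_contra hne
          have hy0 : y ≠ 0 := by
            rintro rfl
            apply hne
            apply hinj _ _ hy hx
            rw [hfx]; tauto
          have := (dist2 x y).2 ⟨hx1, hy0, Ne.symm hne⟩
          rw [← hα x y hx hy, dist2] at this
          exact this.1 hfx
        rw [this]; exact ⟨ha.symm, hfx⟩
      · refine unit_case P f hinj fun x hx => ?_
        constructor
        · intro h; by_contra h2; exact h1 ⟨x, hx, h2, h⟩
        · rintro rfl; tauto

/-! Lower bound -/

theorem exists_gen {n : ℕ} (X : Set (Fin n →. Fin n)) (hX : X ⊆ DPSset n)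
    (hcl : (↑(Submonoid.closure X) : Set (Fin n →. Fin n)) = DPSset n)
    (K : (Fin n →. Fin n) → Prop) (h1 : ¬ K 1)
    (hm : ∀ α β, α ∈ DPSset n → β ∈ DPSset n → K (α * β) → K α ∨ K β)
    (hg : ∃ g ∈ DPSset n, K g) : ∃ x ∈ X, K x := by
  by_contra hno
  push Not at hno
  let S : Submonoid (Fin n →. Fin n) :=
    { carrier := {α | α ∈ DPSset n ∧ ¬ K α}
      one_mem' := ⟨(DPSsub n).one_mem, h1⟩
      mul_mem' := fun {a b} ha hb => ⟨(DPSsub n).mul_mem ha.1 hb.1, fun h => by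
        rcases hm a b ha.1 hb.1 h with h | h
        · exact ha.2 h
        · exact hb.2 h⟩ }
  have : Submonoid.closure X ≤ S := by
    rw [Submonoid.closure_le]
    exact fun x hx => ⟨hX hx, hno x hx⟩
  obtain ⟨g, hg, hk⟩ := hg
  rw [← hcl] at hg
  exact (this hg).2 hk

/-- domain is the complement of `j` -/
def miss {n : ℕ} (j : Fin n) (α : Fin n →. Fin n) : Prop := ∀ x, (α x).Dom ↔ x ≠ j

/-- total -/
def total {n : ℕ} (α : Fin n →. Fin n) : Prop := ∀ x, (α x).Dom

/-- class of maps with domain of size `n-1` -/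
def KK {k : ℕ} (q : Prop) (α : Fin (k+4) →. Fin (k+4)) : Prop :=
  ∃ j, (j = 0 ↔ q) ∧ miss j α

/-- class of maps with `0` mapped to nonzero -/
def KC {k : ℕ} (α : Fin (k+4) →. Fin (k+4)) : Prop := ∃ b ∈ α 0, b ≠ 0

theorem fix0 {k : ℕ} (P : Fin (k+4) → Prop) (f : Fin (k+4) → Fin (k+4))
    (h : mkP P f ∈ DPSset (k+4)) (a b : Fin (k+4)) (ha : a ≠ 0) (hb : b ≠ 0) (hab : a ≠ b)
    (h0 : P 0) (hPa : P a) (hPb : P b) : f 0 = 0 := by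
  rw [isPI_mkP] at h
  have h1 := h 0 a h0 hPa
  have h2 := h a b hPa hPb
  rw [(dist2 a b).2 ⟨ha, hb, hab⟩, dist2] at h2
  rw [dist0 a ha] at h1
  have := dist1 _ _ h1
  tauto

theorem not_KC_of {k : ℕ} (α : Fin (k+4) →. Fin (k+4)) (h : α ∈ DPSset (k+4)) (j : Fin (k+4))
    (hj : j ≠ 0) (hd : ∀ x, x ≠ j → (α x).Dom) : ¬ KC α := by
  obtain ⟨P, f, rfl⟩ := exists_mkP α
  have hd' : ∀ x, x ≠ j → P x := hd
  have : ∃ a b : Fin (k+4), a ≠ 0 ∧ b ≠ 0 ∧ a ≠ b ∧ a ≠ j ∧ b ≠ j := by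
    by_cases h1 : j.val = 1
    · exact ⟨⟨2, by omega⟩, ⟨3, by omega⟩, by simp [Fin.ext_iff, h1]⟩
    · by_cases h2 : j.val = 2
      · exact ⟨⟨1, by omega⟩, ⟨3, by omega⟩, by simp [Fin.ext_iff, h2]⟩
      · exact ⟨⟨1, by omega⟩, ⟨2, by omega⟩, by simp [Fin.ext_iff]; omega⟩
  obtain ⟨a, b, ha, hb, hab, haj, hbj⟩ := this
  have := fix0 P f h a b ha hb hab (hd' _ hj.symm) (hd' _ haj) (hd' _ hbj)
  rintro ⟨c, hc, hc0⟩
  rw [mem_mkP] at hc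
  exact hc0 (hc.2 ▸ this)

theorem total_props {k : ℕ} (P : Fin (k+4) → Prop) (f : Fin (k+4) → Fin (k+4))
    (h : mkP P f ∈ DPSset (k+4)) (ht : ∀ x, P x) : Function.Bijective f ∧ f 0 = 0 := by
  constructor
  · rw [← Finite.injective_iff_bijective]
    intro x y hxy
    rw [isPI_mkP] at h
    rw [← dist_zero, ← h x y (ht _) (ht _), hxy, dist_zero]
  · by_contra hne
    exact not_KC_of _ h 1 (by simp) (fun x _ => ht x) ⟨f 0, (mem_mkP ..).2 ⟨ht 0, rfl⟩, hne⟩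

theorem KK_mul {k : ℕ} (q : Prop) (α β : Fin (k+4) →. Fin (k+4)) (ha : α ∈ DPSset (k+4))
    (h : KK q (α * β)) : KK q α ∨ KK q β := by
  obtain ⟨P, f, rfl⟩ := exists_mkP α
  obtain ⟨Q, g, rfl⟩ := exists_mkP β
  obtain ⟨j, hj, hm⟩ := h
  rw [mkP_mul] at hm
  have hm' : ∀ x, (P x ∧ Q (f x)) ↔ x ≠ j := hm
  by_cases hPj : P j
  · right
    have ht : ∀ x, P x := by
      intro x
      by_cases hx : x = j
      · exact hx ▸ hPj
      · exact ((hm' x).2 hx).1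
    obtain ⟨hb, h0⟩ := total_props P f ha ht
    refine ⟨f j, ?_, ?_⟩
    · rw [← hj]
      constructor
      · intro h; exact hb.1 (h.trans h0.symm)
      · rintro rfl; exact h0
    · intro y
      obtain ⟨x, rfl⟩ := hb.2 y
      change Q (f x) ↔ _
      rw [hb.1.ne_iff, ← hm' x]
      simp [ht]
  · left
    refine ⟨j, hj, fun x => ?_⟩
    change P x ↔ _
    constructor
    · rintro h rfl; exact hPj h
    · intro h; exact ((hm' x).2 h).1

theorem KC_mul {k : ℕ} (α β : Fin (k+4) →. Fin (k+4))
    (h : KC (α * β)) : KC α ∨ KC β := by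
  obtain ⟨c, hc, hc0⟩ := h
  rw [mem_mul'] at hc
  obtain ⟨b, hb, hcb⟩ := hc
  by_cases h : b = 0
  · right; subst h; exact ⟨c, hcb, hc0⟩
  · left; exact ⟨b, hb, h⟩

theorem total_mul {k : ℕ} (α β : Fin (k+4) →. Fin (k+4)) (ha : α ∈ DPSset (k+4))
    (h : total (α * β)) : total α ∧ total β := by
  obtain ⟨P, f, rfl⟩ := exists_mkP α
  obtain ⟨Q, g, rfl⟩ := exists_mkP β
  rw [mkP_mul] at h
  have hm' : ∀ x, (P x ∧ Q (f x)) := h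
  refine ⟨fun x => (hm' x).1, fun y => ?_⟩
  obtain ⟨x, rfl⟩ := (total_props P f ha (fun x => (hm' x).1)).1.2 y
  exact (hm' x).2

theorem exists_unit {k : ℕ} (X : Set (Fin (k+4) →. Fin (k+4))) (hX : X ⊆ DPSset (k+4))
    (hcl : (↑(Submonoid.closure X) : Set (Fin (k+4) →. Fin (k+4))) = DPSset (k+4))
    (u : Fin (k+4) →. Fin (k+4)) : ∃ x ∈ X, total x ∧ x ∉ Submonoid.powers u := by
  refine exists_gen X hX hcl (fun α => total α ∧ α ∉ Submonoid.powers u) ?_ ?_ ?_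
  · exact fun h => h.2 (one_mem _)
  · intro α β ha hb ⟨ht, hn⟩
    have := total_mul α β ha ht
    by_contra hc
    have : α ∈ Submonoid.powers u ∧ β ∈ Submonoid.powers u := by tauto
    exact hn (mul_mem this.1 this.2)
  · by_contra hno
    push Not at hno
    have h1 := hno (uhom (k+3) (Equiv.swap 0 1)) (uhom_mem _) (fun _ => trivial)
    have h2 := hno (uhom (k+3) (Equiv.swap 1 ⟨2, by omega⟩)) (uhom_mem _) (fun _ => trivial)
    obtain ⟨a, ha⟩ := h1
    obtain ⟨b, hb⟩ := h2
    have hc : uhom (k+3) (Equiv.swap 0 1) * uhom (k+3) (Equiv.swap 1 ⟨2, by omega⟩) =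
      uhom (k+3) (Equiv.swap 1 ⟨2, by omega⟩) * uhom (k+3) (Equiv.swap 0 1) := by
      rw [← ha, ← hb]
      exact ((Commute.refl u).pow_pow a b).eq
    rw [uhom_apply, uhom_apply, mkP_mul, mkP_mul] at hc
    have h3 := congrFun hc 1
    have h4 : ∀ c, _ ↔ _ := fun c => iff_of_eq (congrArg (fun t => c ∈ t) h3)
    simp only [mem_mkP] at h4
    have h5 := ((h4 _).1 ⟨⟨trivial, trivial⟩, rfl⟩).2
    have e1 : Equiv.swap (1 : Fin (k+3)) ⟨2, by omega⟩ 0 = 0 :=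
      Equiv.swap_apply_of_ne_of_ne (by simp) (by simp [Fin.ext_iff])
    simp only [Equiv.swap_inv, ext_one, ext_succ, e1, Equiv.swap_apply_left, Fin.succ_inj] at h5
    simp [Fin.ext_iff] at h5

theorem finite_pfun (n : ℕ) : Finite (Fin n →. Fin n) := by
  classical
  have : Function.Injective (fun (α : Fin n →. Fin n) (x : Fin n) => {b | b ∈ α x}) := by
    intro α β h
    refine PFun.ext fun x b => ?_
    have := congrFun h x
    exact Set.ext_iff.1 this b
  exact Finite.of_injective _ this

theorem lower {k : ℕ} (X : Set (Fin (k+4) →. Fin (k+4))) (hX : X ⊆ DPSset (k+4))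
    (hcl : (↑(Submonoid.closure X) : Set (Fin (k+4) →. Fin (k+4))) = DPSset (k+4)) :
    5 ≤ X.ncard := by
  have := finite_pfun (k+4)
  obtain ⟨u, huX, hu, -⟩ := exists_unit X hX hcl 1
  obtain ⟨v, hvX, hv, huv⟩ := exists_unit X hX hcl u
  have n1 : ∀ q : Prop, ¬ KK q (1 : Fin (k+4) →. Fin (k+4)) := by
    rintro q ⟨j, -, h⟩
    exact (h j).1 trivial rfl
  obtain ⟨a, haX, ja, hja, ha⟩ := exists_gen X hX hcl (KK True) (n1 _)
    (fun α β h _ => KK_mul _ α β h)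
    ⟨res (fun x => x ≠ 0), res_mem _, 0, by simp, fun x => Iff.rfl⟩
  obtain ⟨b, hbX, jb, hjb, hb⟩ := exists_gen X hX hcl (KK False) (n1 _)
    (fun α β h _ => KK_mul _ α β h)
    ⟨res (fun x => x ≠ 1), res_mem _, 1, by simp, fun x => Iff.rfl⟩
  obtain ⟨c, hcX, hc⟩ := exists_gen X hX hcl KC
    (by rintro ⟨b, hb, hb0⟩; exact hb0 ((mem_one' _ _).1 hb))
    (fun α β _ _ => KC_mul α β)
    ⟨sw (k+2), sw_mem _, 1, (mem_mkP ..).2 (by simp), by simp⟩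
  have hja : ja = 0 := by simpa using hja
  have hjb : jb ≠ 0 := by simpa using hjb
  have tm : ∀ (x : Fin (k+4) →. Fin (k+4)) j, total x → ¬ miss j x :=
    fun x j h1 h2 => (h2 j).1 (h1 j) rfl
  have huC : ¬ KC u := not_KC_of u (hX huX) 1 (by simp) (fun x _ => hu x)
  have hvC : ¬ KC v := not_KC_of v (hX hvX) 1 (by simp) (fun x _ => hv x)
  have hbC : ¬ KC b := not_KC_of b (hX hbX) jb hjb (fun x h => (hb x).2 h)
  have haC : ¬ KC a := by
    rintro ⟨y, ⟨hy, -⟩, -⟩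
    exact (ha 0).1 hy hja.symm
  have e1 : u ≠ v := by rintro rfl; exact huv (Submonoid.mem_powers u)
  have e2 : u ≠ a := by rintro rfl; exact tm _ _ hu ha
  have e3 : u ≠ b := by rintro rfl; exact tm _ _ hu hb
  have e4 : u ≠ c := by rintro rfl; exact huC hc
  have e5 : v ≠ a := by rintro rfl; exact tm _ _ hv ha
  have e6 : v ≠ b := by rintro rfl; exact tm _ _ hv hb
  have e7 : v ≠ c := by rintro rfl; exact hvC hc
  have e8 : a ≠ b := by
    rintro rfl
    exact (hb jb).1 ((ha jb).2 (by rw [hja]; exact hjb)) rfl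
  have e9 : a ≠ c := by rintro rfl; exact haC hc
  have e10 : b ≠ c := by rintro rfl; exact hbC hc
  classical
  have hcard : (({u, v, a, b, c} : Finset (Fin (k+4) →. Fin (k+4)))).card = 5 := by
    rw [Finset.card_insert_of_notMem, Finset.card_insert_of_notMem, Finset.card_insert_of_notMem,
      Finset.card_insert_of_notMem, Finset.card_singleton] <;> simp [*]
  rw [← hcard, ← Set.ncard_coe_finset]
  refine Set.ncard_le_ncard ?_ (Set.toFinite X)
  intro x hx
  simp only [Finset.coe_insert, Finset.coe_singleton, Set.mem_insert_iff,
    Set.mem_singleton_iff] at hx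
  rcases hx with rfl | rfl | rfl | rfl | rfl <;> assumption

theorem gens_le (k : ℕ) : (gens k).ncard ≤ 5 := by
  unfold gens
  refine (Set.ncard_insert_le _ _).trans ?_
  refine Nat.succ_le_succ ((Set.ncard_insert_le _ _).trans ?_)
  refine Nat.succ_le_succ ((Set.ncard_insert_le _ _).trans ?_)
  refine Nat.succ_le_succ ((Set.ncard_insert_le _ _).trans ?_)
  simp

theorem statement11 (n : ℕ) (hn : 4 ≤ n) :
    IsLeast { k : ℕ | ∃ X : Set (Fin n →. Fin n), X ⊆ DPSset n ∧
      (↑(Submonoid.closure X) : Set (Fin n →. Fin n)) = DPSset n ∧ X.ncard = k } 5 := by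
  obtain ⟨k, rfl⟩ : ∃ k, n = k + 4 := ⟨n - 4, by omega⟩
  constructor
  · exact ⟨gens k, gens_sub k, gens_closure k,
      le_antisymm (gens_le k) (lower _ (gens_sub k) (gens_closure k))⟩
  · rintro m ⟨X, hX, hcl, rfl⟩
    exact lower X hX hcl

end DPSPaper
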